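/- The Willmore energy of an immersed torus in ℝ³ is invariant under the inversion x ↦ x/‖x‖²: if f : ℝ² → ℝ³ is a smooth immersion, 2π-periodic in each variable, whose image does not contain the origin, then with I(x) = x/‖x‖² the map I∘f is again a smooth immersion, 2π-periodic in each variable, and W(I∘f) = W(f). -/

import Mathlib

open Real MeasureTheory RealInnerProductSpace

noncomputable section

/-- First partial derivative (in the first variable). -/
def pd1 (f : ℝ → ℝ → EuclideanSpace ℝ (Fin 3)) (u v : ℝ) : EuclideanSpace ℝ (Fin 3) :=
  deriv (fun x => f x v) u

/-- Second partial derivative (in the second variable). -/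
def pd2 (f : ℝ → ℝ → EuclideanSpace ℝ (Fin 3)) (u v : ℝ) : EuclideanSpace ℝ (Fin 3) :=
  deriv (fun y => f u y) v

/-- Cross product on Euclidean 3-space. -/
def cross3 (a b : EuclideanSpace ℝ (Fin 3)) : EuclideanSpace ℝ (Fin 3) :=
  (EuclideanSpace.equiv (Fin 3) ℝ).symm
    ![a 1 * b 2 - a 2 * b 1, a 2 * b 0 - a 0 * b 2, a 0 * b 1 - a 1 * b 0]

/-- Coefficients of the first fundamental form. -/
def coeffE (f : ℝ → ℝ → EuclideanSpace ℝ (Fin 3)) (u v : ℝ) : ℝ := ‖pd1 f u v‖ ^ 2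

def coeffF (f : ℝ → ℝ → EuclideanSpace ℝ (Fin 3)) (u v : ℝ) : ℝ := ⟪pd1 f u v, pd2 f u v⟫

def coeffG (f : ℝ → ℝ → EuclideanSpace ℝ (Fin 3)) (u v : ℝ) : ℝ := ‖pd2 f u v‖ ^ 2

/-- The unit normal. -/
def unitNormal (f : ℝ → ℝ → EuclideanSpace ℝ (Fin 3)) (u v : ℝ) : EuclideanSpace ℝ (Fin 3) :=
  ‖cross3 (pd1 f u v) (pd2 f u v)‖⁻¹ • cross3 (pd1 f u v) (pd2 f u v)

/-- Coefficients of the second fundamental form. -/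
def coeffL (f : ℝ → ℝ → EuclideanSpace ℝ (Fin 3)) (u v : ℝ) : ℝ :=
  ⟪pd1 (pd1 f) u v, unitNormal f u v⟫

def coeffM (f : ℝ → ℝ → EuclideanSpace ℝ (Fin 3)) (u v : ℝ) : ℝ :=
  ⟪pd1 (pd2 f) u v, unitNormal f u v⟫

def coeffN (f : ℝ → ℝ → EuclideanSpace ℝ (Fin 3)) (u v : ℝ) : ℝ :=
  ⟪pd2 (pd2 f) u v, unitNormal f u v⟫

/-- The mean curvature. -/
def meanCurv (f : ℝ → ℝ → EuclideanSpace ℝ (Fin 3)) (u v : ℝ) : ℝ :=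
  (coeffE f u v * coeffN f u v - 2 * coeffF f u v * coeffM f u v
      + coeffG f u v * coeffL f u v) /
    (2 * (coeffE f u v * coeffG f u v - coeffF f u v ^ 2))

/-- The Willmore energy of a doubly `2π`-periodic immersion `f : ℝ² → ℝ³`. -/
def willmoreEnergy (f : ℝ → ℝ → EuclideanSpace ℝ (Fin 3)) : ℝ :=
  ∫ u in (0 : ℝ)..(2 * π), ∫ v in (0 : ℝ)..(2 * π),
    meanCurv f u v ^ 2 *
      Real.sqrt (coeffE f u v * coeffG f u v - coeffF f u v ^ 2)

/-- Inversion of `ℝ³` in the unit sphere: `x ↦ x/‖x‖²`. -/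
def sphereInv (x : EuclideanSpace ℝ (Fin 3)) : EuclideanSpace ℝ (Fin 3) :=
  (‖x‖ ^ 2)⁻¹ • x

/-- The differential of `sphereInv` at `x`. -/
def sphereInvDeriv (x w : EuclideanSpace ℝ (Fin 3)) : EuclideanSpace ℝ (Fin 3) :=
  (‖x‖ ^ 2)⁻¹ • w - (2 * ⟪x, w⟫ * ((‖x‖ ^ 2)⁻¹) ^ 2) • x

/-- The derivative of `sphereInvDeriv` along a curve with velocity `d` carrying a vector field
with value `w` and derivative `w'`. -/
def sphereInvDeriv₂ (x w d w' : EuclideanSpace ℝ (Fin 3)) : EuclideanSpace ℝ (Fin 3) :=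
  (‖x‖ ^ 2)⁻¹ • w' - (2 * ⟪x, d⟫ * ((‖x‖ ^ 2)⁻¹) ^ 2) • w
    - (2 * (⟪d, w⟫ + ⟪x, w'⟫) * ((‖x‖ ^ 2)⁻¹) ^ 2
        - 8 * ⟪x, w⟫ * ⟪x, d⟫ * ((‖x‖ ^ 2)⁻¹) ^ 3) • x
    - (2 * ⟪x, w⟫ * ((‖x‖ ^ 2)⁻¹) ^ 2) • d

/-- The Gram determinant of two vectors. -/
def gram (a b : EuclideanSpace ℝ (Fin 3)) : ℝ := ‖a‖ ^ 2 * ‖b‖ ^ 2 - ⟪a, b⟫ ^ 2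

/-- The numerator of the mean curvature, with respect to the unnormalized normal `a × b`. -/
def curvNumerator (a b p q r : EuclideanSpace ℝ (Fin 3)) : ℝ :=
  ‖a‖ ^ 2 * ⟪r, cross3 a b⟫ - 2 * ⟪a, b⟫ * ⟪q, cross3 a b⟫ + ‖b‖ ^ 2 * ⟪p, cross3 a b⟫

/-- The Willmore integrand in terms of first and second partial derivatives. -/
def willmoreDensity (a b p q r : EuclideanSpace ℝ (Fin 3)) : ℝ :=
  curvNumerator a b p q r ^ 2 / (4 * gram a b ^ 2 * √(gram a b))

/-- The component in the direction of `a` of the densitized gradient of `log ‖x‖ ^ 2`. -/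
def logFlux (x a b : EuclideanSpace ℝ (Fin 3)) : ℝ :=
  2 * (‖b‖ ^ 2 * ⟪x, a⟫ - ⟪a, b⟫ * ⟪x, b⟫) / (‖x‖ ^ 2 * √(gram a b))

/-- The derivative of `logFlux` along a curve with velocity `a` along which `a` and `b` have
derivatives `p` and `q`. -/
def logFluxDeriv (x a b p q : EuclideanSpace ℝ (Fin 3)) : ℝ :=
  (2 * (2 * ⟪b, q⟫ * ⟪x, a⟫ + ‖b‖ ^ 2 * (‖a‖ ^ 2 + ⟪x, p⟫)
      - (⟪a, q⟫ + ⟪b, p⟫) * ⟪x, b⟫ - ⟪a, b⟫ * (⟪a, b⟫ + ⟪x, q⟫)) * (‖x‖ ^ 2 * √(gram a b))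
    - 2 * (‖b‖ ^ 2 * ⟪x, a⟫ - ⟪a, b⟫ * ⟪x, b⟫) * (2 * ⟪x, a⟫ * √(gram a b)
      + ‖x‖ ^ 2 * ((⟪a, p⟫ * ‖b‖ ^ 2 + ‖a‖ ^ 2 * ⟪b, q⟫ - ⟪a, b⟫ * (⟪a, q⟫ + ⟪b, p⟫))
        / √(gram a b)))) / (‖x‖ ^ 2 * √(gram a b)) ^ 2

lemma gram_comm (a b : EuclideanSpace ℝ (Fin 3)) : gram a b = gram b a := by
  rw [gram, gram, real_inner_comm, mul_comm]

lemma inner_eq_sum (a b : EuclideanSpace ℝ (Fin 3)) :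
    ⟪a, b⟫ = a 0 * b 0 + a 1 * b 1 + a 2 * b 2 := by
  simp [PiLp.inner_apply, Fin.sum_univ_three]; ring

lemma norm_sq_eq_sum (a : EuclideanSpace ℝ (Fin 3)) :
    ‖a‖ ^ 2 = a 0 ^ 2 + a 1 ^ 2 + a 2 ^ 2 := by
  rw [← real_inner_self_eq_norm_sq, inner_eq_sum]; ring

@[simp] lemma cross3_zero (a b : EuclideanSpace ℝ (Fin 3)) :
    cross3 a b 0 = a 1 * b 2 - a 2 * b 1 := by simp [cross3]

@[simp] lemma cross3_one (a b : EuclideanSpace ℝ (Fin 3)) :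
    cross3 a b 1 = a 2 * b 0 - a 0 * b 2 := by simp [cross3]

@[simp] lemma cross3_two (a b : EuclideanSpace ℝ (Fin 3)) :
    cross3 a b 2 = a 0 * b 1 - a 1 * b 0 := by simp [cross3]

lemma norm_cross3_sq (a b : EuclideanSpace ℝ (Fin 3)) : ‖cross3 a b‖ ^ 2 = gram a b := by
  simp only [gram, norm_sq_eq_sum, inner_eq_sum, cross3_zero, cross3_one, cross3_two]; ring

lemma norm_cross3 (a b : EuclideanSpace ℝ (Fin 3)) : ‖cross3 a b‖ = √(gram a b) := by
  rw [← norm_cross3_sq, Real.sqrt_sq (norm_nonneg _)]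

lemma inner_left_cross3 (a b : EuclideanSpace ℝ (Fin 3)) : ⟪a, cross3 a b⟫ = 0 := by
  simp only [inner_eq_sum, cross3_zero, cross3_one, cross3_two]; ring

lemma inner_right_cross3 (a b : EuclideanSpace ℝ (Fin 3)) : ⟪b, cross3 a b⟫ = 0 := by
  simp only [inner_eq_sum, cross3_zero, cross3_one, cross3_two]; ring

/-- The product of two triple products is the determinant of the mixed Gram matrix. -/
lemma inner_cross3_mul (x p a b : EuclideanSpace ℝ (Fin 3)) :
    ⟪x, cross3 a b⟫ * ⟪p, cross3 a b⟫ =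
      ⟪x, p⟫ * gram a b - ⟪x, a⟫ * (⟪a, p⟫ * ‖b‖ ^ 2 - ⟪b, p⟫ * ⟪a, b⟫)
        + ⟪x, b⟫ * (⟪a, p⟫ * ⟪a, b⟫ - ⟪b, p⟫ * ‖a‖ ^ 2) := by
  simp only [gram, norm_sq_eq_sum, inner_eq_sum, cross3_zero, cross3_one, cross3_two]; ring

lemma inner_sphereInvDeriv {x : EuclideanSpace ℝ (Fin 3)} (hx : x ≠ 0)
    (a b : EuclideanSpace ℝ (Fin 3)) :
    ⟪sphereInvDeriv x a, sphereInvDeriv x b⟫ = ((‖x‖ ^ 2)⁻¹) ^ 2 * ⟪a, b⟫ := by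
  have : ‖x‖ ≠ 0 := norm_ne_zero_iff.2 hx
  simp only [sphereInvDeriv, inner_sub_left, inner_sub_right, real_inner_smul_left,
    real_inner_smul_right, real_inner_self_eq_norm_sq, real_inner_comm x a]
  field_simp
  ring

lemma norm_sphereInvDeriv_sq {x : EuclideanSpace ℝ (Fin 3)} (hx : x ≠ 0)
    (a : EuclideanSpace ℝ (Fin 3)) :
    ‖sphereInvDeriv x a‖ ^ 2 = ((‖x‖ ^ 2)⁻¹) ^ 2 * ‖a‖ ^ 2 := by
  simpa only [real_inner_self_eq_norm_sq] using inner_sphereInvDeriv hx a a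

lemma gram_sphereInvDeriv {x : EuclideanSpace ℝ (Fin 3)} (hx : x ≠ 0)
    (a b : EuclideanSpace ℝ (Fin 3)) :
    gram (sphereInvDeriv x a) (sphereInvDeriv x b) = ((‖x‖ ^ 2)⁻¹) ^ 4 * gram a b := by
  simp only [gram, norm_sphereInvDeriv_sq hx, inner_sphereInvDeriv hx]; ring

lemma cross3_sphereInvDeriv {x : EuclideanSpace ℝ (Fin 3)} (hx : x ≠ 0)
    (a b : EuclideanSpace ℝ (Fin 3)) :
    cross3 (sphereInvDeriv x a) (sphereInvDeriv x b) =
      ((‖x‖ ^ 2)⁻¹) ^ 2 • ((2 * ⟪x, cross3 a b⟫ * (‖x‖ ^ 2)⁻¹) • x - cross3 a b) := by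
  have h : ‖x‖ ≠ 0 := norm_ne_zero_iff.2 hx
  have hρ : (‖x‖ ^ 2)⁻¹ * ‖x‖ ^ 2 = 1 := inv_mul_cancel₀ (pow_ne_zero 2 h)
  have key (i : Fin 3) : ⟪x, b⟫ * cross3 a x i + ⟪x, a⟫ * cross3 x b i =
      ‖x‖ ^ 2 * cross3 a b i - ⟪x, cross3 a b⟫ * x i := by
    simp only [norm_sq_eq_sum, inner_eq_sum, cross3_zero, cross3_one, cross3_two]
    fin_cases i <;> simp <;> ring
  have bilin (i : Fin 3) (α s t : ℝ) : cross3 (α • a - s • x) (α • b - t • x) i =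
      α ^ 2 * cross3 a b i - α * t * cross3 a x i - α * s * cross3 x b i := by
    fin_cases i <;> simp <;> ring
  ext i
  rw [sphereInvDeriv, sphereInvDeriv, bilin]
  simp only [PiLp.smul_apply, PiLp.sub_apply, smul_eq_mul]
  linear_combination (-2 * ((‖x‖ ^ 2)⁻¹) ^ 3) * key i
    - 2 * ((‖x‖ ^ 2)⁻¹) ^ 2 * cross3 a b i * hρ

lemma inner_sphereInvDeriv₂ {x : EuclideanSpace ℝ (Fin 3)} (hx : x ≠ 0)
    (a b w d w' : EuclideanSpace ℝ (Fin 3)) (hw : ⟪w, cross3 a b⟫ = 0)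
    (hd : ⟪d, cross3 a b⟫ = 0) :
    ⟪sphereInvDeriv₂ x w d w', cross3 (sphereInvDeriv x a) (sphereInvDeriv x b)⟫ =
      -((‖x‖ ^ 2)⁻¹) ^ 3 *
        (⟪w', cross3 a b⟫ + 2 * ⟪d, w⟫ * ⟪x, cross3 a b⟫ * (‖x‖ ^ 2)⁻¹) := by
  have : ‖x‖ ≠ 0 := norm_ne_zero_iff.2 hx
  rw [cross3_sphereInvDeriv hx]
  simp only [sphereInvDeriv₂, inner_sub_left, inner_sub_right, real_inner_smul_left,
    real_inner_smul_right, real_inner_self_eq_norm_sq, hw, hd, real_inner_comm x w,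
    real_inner_comm x d, real_inner_comm x w']
  field_simp
  ring

lemma curvNumerator_sphereInvDeriv {x : EuclideanSpace ℝ (Fin 3)} (hx : x ≠ 0)
    (a b p q r : EuclideanSpace ℝ (Fin 3)) :
    curvNumerator (sphereInvDeriv x a) (sphereInvDeriv x b) (sphereInvDeriv₂ x a a p)
        (sphereInvDeriv₂ x b a q) (sphereInvDeriv₂ x b b r) =
      -((‖x‖ ^ 2)⁻¹) ^ 5 *
        (curvNumerator a b p q r + 4 * gram a b * ⟪x, cross3 a b⟫ * (‖x‖ ^ 2)⁻¹) := by
  have ha := inner_left_cross3 a b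
  have hb := inner_right_cross3 a b
  simp only [curvNumerator, norm_sphereInvDeriv_sq hx, inner_sphereInvDeriv hx,
    inner_sphereInvDeriv₂ hx a b _ _ _ ha ha, inner_sphereInvDeriv₂ hx a b _ _ _ hb ha,
    inner_sphereInvDeriv₂ hx a b _ _ _ hb hb, real_inner_self_eq_norm_sq, gram]
  ring

/-- The densitized Laplacian of `log ‖x‖ ^ 2` on the immersed surface. -/
lemma logFluxDeriv_add {x a b : EuclideanSpace ℝ (Fin 3)} (hx : x ≠ 0) (hab : 0 < gram a b)
    (p q r : EuclideanSpace ℝ (Fin 3)) :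
    logFluxDeriv x a b p q + logFluxDeriv x b a r q =
      2 * curvNumerator a b p q r * ⟪x, cross3 a b⟫ / (√(gram a b) ^ 3 * ‖x‖ ^ 2)
        + 4 * ⟪x, cross3 a b⟫ ^ 2 / (√(gram a b) * (‖x‖ ^ 2) ^ 2) := by
  have h : ‖x‖ ≠ 0 := norm_ne_zero_iff.2 hx
  have hW : √(gram a b) ≠ 0 := (Real.sqrt_pos.2 hab).ne'
  have hW2 : √(gram a b) ^ 2 = gram a b := Real.sq_sqrt hab.le
  have hp := inner_cross3_mul x p a b
  have hq := inner_cross3_mul x q a b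
  have hr := inner_cross3_mul x r a b
  have ht := inner_cross3_mul x x a b
  have clear_sqrt {W D ρ : ℝ} (hW : W ≠ 0) (hρ : ρ ≠ 0) (hD : W ^ 2 = D) (N N' x D' : ℝ) :
      (2 * N' * (ρ * W) - 2 * N * (2 * x * W + ρ * (D' / W))) / (ρ * W) ^ 2 =
        (2 * N' * ρ * D - 2 * N * (2 * x * D + ρ * D')) / (ρ ^ 2 * W ^ 3) := by
    subst hD
    field_simp
  have hrhs : 2 * curvNumerator a b p q r * ⟪x, cross3 a b⟫ / (√(gram a b) ^ 3 * ‖x‖ ^ 2)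
      + 4 * ⟪x, cross3 a b⟫ ^ 2 / (√(gram a b) * (‖x‖ ^ 2) ^ 2) =
      (2 * curvNumerator a b p q r * ⟪x, cross3 a b⟫ * ‖x‖ ^ 2
        + 4 * ⟪x, cross3 a b⟫ ^ 2 * gram a b) / ((‖x‖ ^ 2) ^ 2 * √(gram a b) ^ 3) := by
    rw [← hW2, Real.sqrt_sq (Real.sqrt_nonneg _)]
    field_simp
  rw [hrhs, logFluxDeriv, logFluxDeriv, gram_comm b a, clear_sqrt hW (pow_ne_zero 2 h) hW2,
    clear_sqrt hW (pow_ne_zero 2 h) hW2, ← add_div]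
  congr 1
  rw [curvNumerator]
  simp only [gram, real_inner_self_eq_norm_sq, real_inner_comm x a, real_inner_comm x b,
    real_inner_comm a b] at *
  linear_combination (-2 * ‖x‖ ^ 2 * ‖a‖ ^ 2) * hr + (4 * ‖x‖ ^ 2 * ⟪a, b⟫) * hq
    - (2 * ‖x‖ ^ 2 * ‖b‖ ^ 2) * hp - 4 * (‖a‖ ^ 2 * ‖b‖ ^ 2 - ⟪a, b⟫ ^ 2) * ht

lemma willmoreDensity_sphereInvDeriv {x a b : EuclideanSpace ℝ (Fin 3)} (hx : x ≠ 0)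
    (hab : 0 < gram a b) (p q r : EuclideanSpace ℝ (Fin 3)) :
    willmoreDensity (sphereInvDeriv x a) (sphereInvDeriv x b) (sphereInvDeriv₂ x a a p)
        (sphereInvDeriv₂ x b a q) (sphereInvDeriv₂ x b b r) =
      willmoreDensity a b p q r + (logFluxDeriv x a b p q + logFluxDeriv x b a r q) := by
  have h : ‖x‖ ≠ 0 := norm_ne_zero_iff.2 hx
  have hW : √(gram a b) ≠ 0 := (Real.sqrt_pos.2 hab).ne'
  have hW2 : gram a b = √(gram a b) ^ 2 := (Real.sq_sqrt hab.le).symm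
  have hs : √(((‖x‖ ^ 2)⁻¹) ^ 4 * gram a b) = ((‖x‖ ^ 2)⁻¹) ^ 2 * √(gram a b) := by
    rw [Real.sqrt_mul (by positivity),
      show ((‖x‖ ^ 2)⁻¹) ^ 4 = (((‖x‖ ^ 2)⁻¹) ^ 2) ^ 2 by ring, Real.sqrt_sq (by positivity)]
  rw [logFluxDeriv_add hx hab, willmoreDensity, willmoreDensity, gram_sphereInvDeriv hx,
    curvNumerator_sphereInvDeriv hx, hs]
  generalize √(gram a b) = W at *
  rw [hW2]
  field_simp
  ring

section PartialDerivatives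

variable {F : Type*} [NormedAddCommGroup F] [NormedSpace ℝ F]

lemma hasDerivAt_fderiv_fst {g : ℝ × ℝ → F} {u v : ℝ} (hg : DifferentiableAt ℝ g (u, v)) :
    HasDerivAt (fun x => g (x, v)) (fderiv ℝ g (u, v) (1, 0)) u :=
  hg.hasFDerivAt.comp_hasDerivAt u ((hasDerivAt_id u).prodMk (hasDerivAt_const u v))

lemma hasDerivAt_fderiv_snd {g : ℝ × ℝ → F} {u v : ℝ} (hg : DifferentiableAt ℝ g (u, v)) :
    HasDerivAt (fun y => g (u, y)) (fderiv ℝ g (u, v) (0, 1)) v :=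
  hg.hasFDerivAt.comp_hasDerivAt v ((hasDerivAt_const v u).prodMk (hasDerivAt_id v))

end PartialDerivatives

section SmoothMaps

variable {f : ℝ → ℝ → EuclideanSpace ℝ (Fin 3)}

lemma pd1_eq_fderiv (hf : ContDiff ℝ (⊤ : ℕ∞) (fun p : ℝ × ℝ => f p.1 p.2)) (u v : ℝ) :
    pd1 f u v = fderiv ℝ (fun p : ℝ × ℝ => f p.1 p.2) (u, v) (1, 0) :=
  (hasDerivAt_fderiv_fst (hf.differentiable (by simp) (u, v))).deriv

lemma pd2_eq_fderiv (hf : ContDiff ℝ (⊤ : ℕ∞) (fun p : ℝ × ℝ => f p.1 p.2)) (u v : ℝ) :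
    pd2 f u v = fderiv ℝ (fun p : ℝ × ℝ => f p.1 p.2) (u, v) (0, 1) :=
  (hasDerivAt_fderiv_snd (hf.differentiable (by simp) (u, v))).deriv

lemma hasDerivAt_pd1 (hf : ContDiff ℝ (⊤ : ℕ∞) (fun p : ℝ × ℝ => f p.1 p.2)) (u v : ℝ) :
    HasDerivAt (fun x => f x v) (pd1 f u v) u := by
  rw [pd1_eq_fderiv hf]
  exact hasDerivAt_fderiv_fst (hf.differentiable (by simp) (u, v))

lemma hasDerivAt_pd2 (hf : ContDiff ℝ (⊤ : ℕ∞) (fun p : ℝ × ℝ => f p.1 p.2)) (u v : ℝ) :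
    HasDerivAt (fun y => f u y) (pd2 f u v) v := by
  rw [pd2_eq_fderiv hf]
  exact hasDerivAt_fderiv_snd (hf.differentiable (by simp) (u, v))

lemma contDiff_pd1 (hf : ContDiff ℝ (⊤ : ℕ∞) (fun p : ℝ × ℝ => f p.1 p.2)) :
    ContDiff ℝ (⊤ : ℕ∞) (fun p : ℝ × ℝ => pd1 f p.1 p.2) := by
  simp only [pd1_eq_fderiv hf]
  exact (hf.fderiv_right (m := (⊤ : ℕ∞)) (by simp)).clm_apply contDiff_const

lemma contDiff_pd2 (hf : ContDiff ℝ (⊤ : ℕ∞) (fun p : ℝ × ℝ => f p.1 p.2)) :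
    ContDiff ℝ (⊤ : ℕ∞) (fun p : ℝ × ℝ => pd2 f p.1 p.2) := by
  simp only [pd2_eq_fderiv hf]
  exact (hf.fderiv_right (m := (⊤ : ℕ∞)) (by simp)).clm_apply contDiff_const

lemma pd2_pd1_eq_pd1_pd2 (hf : ContDiff ℝ (⊤ : ℕ∞) (fun p : ℝ × ℝ => f p.1 p.2)) (u v : ℝ) :
    pd2 (pd1 f) u v = pd1 (pd2 f) u v := by
  have hd : Differentiable ℝ (fderiv ℝ (fun p : ℝ × ℝ => f p.1 p.2)) :=
    (hf.fderiv_right (m := (⊤ : ℕ∞)) (by simp)).differentiable (by simp)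
  have hsymm := (hf.contDiffAt (x := (u, v))).isSymmSndFDerivAt
    (by simpa using WithTop.coe_le_coe.2 (le_top (a := (2 : ℕ∞)))) (1, 0) (0, 1)
  have h1 := (hasDerivAt_fderiv_snd (hd (u, v))).clm_apply
    (hasDerivAt_const v ((1 : ℝ), (0 : ℝ)))
  have h2 := (hasDerivAt_fderiv_fst (hd (u, v))).clm_apply
    (hasDerivAt_const u ((0 : ℝ), (1 : ℝ)))
  rw [pd2, pd1]
  simp only [pd1_eq_fderiv hf, pd2_eq_fderiv hf]
  rw [h1.deriv, h2.deriv]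
  simpa using hsymm.symm

lemma pd1_add_left {T : ℝ} (hT : ∀ u v, f (u + T) v = f u v) (u v : ℝ) :
    pd1 f (u + T) v = pd1 f u v := by
  simp only [pd1, ← deriv_comp_add_const, hT]

lemma pd2_add_left {T : ℝ} (hT : ∀ u v, f (u + T) v = f u v) (u v : ℝ) :
    pd2 f (u + T) v = pd2 f u v := by
  simp only [pd2, hT]

lemma pd1_add_right {T : ℝ} (hT : ∀ u v, f u (v + T) = f u v) (u v : ℝ) :
    pd1 f u (v + T) = pd1 f u v := by
  simp only [pd1, hT]

lemma pd2_add_right {T : ℝ} (hT : ∀ u v, f u (v + T) = f u v) (u v : ℝ) :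
    pd2 f u (v + T) = pd2 f u v := by
  simp only [pd2, ← deriv_comp_add_const, hT]

end SmoothMaps

section Curves

variable {c w a b : ℝ → EuclideanSpace ℝ (Fin 3)} {d w' p q : EuclideanSpace ℝ (Fin 3)} {t : ℝ}

lemma hasDerivAt_sphereInv (hc : HasDerivAt c d t) (h0 : c t ≠ 0) :
    HasDerivAt (fun s => sphereInv (c s)) (sphereInvDeriv (c t) d) t := by
  have h : ‖c t‖ ≠ 0 := norm_ne_zero_iff.2 h0
  refine ((hc.norm_sq.inv (pow_ne_zero 2 h)).smul hc).congr_deriv ?_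
  simp only [sphereInvDeriv, Pi.inv_apply]
  match_scalars <;> field_simp

lemma hasDerivAt_sphereInvDeriv (hc : HasDerivAt c d t) (hw : HasDerivAt w w' t)
    (h0 : c t ≠ 0) :
    HasDerivAt (fun s => sphereInvDeriv (c s) (w s)) (sphereInvDeriv₂ (c t) (w t) d w') t := by
  have h : ‖c t‖ ≠ 0 := norm_ne_zero_iff.2 h0
  have hρ := hc.norm_sq.inv (pow_ne_zero 2 h)
  refine ((hρ.smul hw).sub
    ((((hc.inner ℝ hw).const_mul 2).mul (hρ.pow 2)).smul hc)).congr_deriv ?_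
  simp only [sphereInvDeriv₂, Pi.inv_apply, Pi.pow_apply, Pi.mul_apply, Nat.reduceSub, pow_one]
  match_scalars
  all_goals field_simp
  all_goals ring

lemma hasDerivAt_gram (ha : HasDerivAt a p t) (hb : HasDerivAt b q t) :
    HasDerivAt (fun s => gram (a s) (b s)) (2 * (⟪a t, p⟫ * ‖b t‖ ^ 2 + ‖a t‖ ^ 2 * ⟪b t, q⟫
      - ⟪a t, b t⟫ * (⟪a t, q⟫ + ⟪b t, p⟫))) t := by
  refine ((ha.norm_sq.mul hb.norm_sq).sub ((ha.inner ℝ hb).pow 2)).congr_deriv ?_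
  rw [real_inner_comm p (b t)]
  ring

lemma hasDerivAt_logFlux (hc : HasDerivAt c (a t) t) (ha : HasDerivAt a p t)
    (hb : HasDerivAt b q t) (h0 : c t ≠ 0) (hab : 0 < gram (a t) (b t)) :
    HasDerivAt (fun s => logFlux (c s) (a s) (b s)) (logFluxDeriv (c t) (a t) (b t) p q) t := by
  have hW := (hasDerivAt_gram ha hb).sqrt hab.ne'
  have hW0 : √(gram (a t) (b t)) ≠ 0 := (Real.sqrt_pos.2 hab).ne'
  have hN := (((hb.norm_sq.mul (hc.inner ℝ ha)).sub
    ((ha.inner ℝ hb).mul (hc.inner ℝ hb))).const_mul 2)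
  have hρ : ‖c t‖ ^ 2 ≠ 0 := pow_ne_zero 2 (norm_ne_zero_iff.2 h0)
  refine (hN.div (hc.norm_sq.mul hW) (mul_ne_zero hρ hW0)).congr_deriv ?_
  rw [logFluxDeriv]
  simp only [real_inner_self_eq_norm_sq, real_inner_comm p (b t), Pi.mul_apply, Pi.sub_apply]
  congr 1
  field_simp
  ring

end Curves

/-- The integral of a divergence over a torus vanishes. -/
lemma integral_divergence_eq_zero {P Q dP dQ : ℝ → ℝ → ℝ} {T : ℝ}
    (hP : ContDiff ℝ 1 (fun p : ℝ × ℝ => P p.1 p.2))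
    (hQ : ContDiff ℝ 1 (fun p : ℝ × ℝ => Q p.1 p.2))
    (hdP : ∀ u v, HasDerivAt (fun x => P x v) (dP u v) u)
    (hdQ : ∀ u v, HasDerivAt (fun y => Q u y) (dQ u v) v)
    (hPT : ∀ v, P T v = P 0 v) (hQT : ∀ u, Q u T = Q u 0) :
    ∫ u in (0 : ℝ)..T, ∫ v in (0 : ℝ)..T, (dP u v + dQ u v) = 0 := by
  have hP' := hP.differentiable one_ne_zero
  have hQ' := hQ.differentiable one_ne_zero
  have hcont : Continuous fun x : ℝ × ℝ =>
      fderiv ℝ (fun p : ℝ × ℝ => P p.1 p.2) x (1, 0)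
        + fderiv ℝ (fun p : ℝ × ℝ => Q p.1 p.2) x (0, 1) :=
    ((hP.continuous_fderiv one_ne_zero).clm_apply continuous_const).add
      ((hQ.continuous_fderiv one_ne_zero).clm_apply continuous_const)
  have key := integral2_divergence_prod_of_hasFDerivAt (fun p : ℝ × ℝ => P p.1 p.2)
    (fun p : ℝ × ℝ => Q p.1 p.2) _ _ 0 0 T T hP.continuous.continuousOn
    hQ.continuous.continuousOn (fun x _ => (hP' x).hasFDerivAt)
    (fun x _ => (hQ' x).hasFDerivAt)
    (hcont.continuousOn.integrableOn_compact (isCompact_uIcc.prod isCompact_uIcc))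
  simp only [hPT, hQT, sub_self, zero_add] at key
  rw [← key]
  congr! 4 with u v
  rw [(hdP u v).unique (hasDerivAt_fderiv_fst (hP' (u, v))),
    (hdQ u v).unique (hasDerivAt_fderiv_snd (hQ' (u, v)))]

lemma gram_pos {a b : EuclideanSpace ℝ (Fin 3)} (h : LinearIndependent ℝ ![a, b]) :
    0 < gram a b := by
  have hsq : ‖‖b‖ ^ 2 • a - ⟪a, b⟫ • b‖ ^ 2 = ‖b‖ ^ 2 * gram a b := by
    rw [← real_inner_self_eq_norm_sq]
    simp only [inner_sub_left, inner_sub_right, real_inner_smul_left, real_inner_smul_right,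
      real_inner_self_eq_norm_sq, real_inner_comm a b, norm_smul, mul_pow, Real.norm_eq_abs,
      sq_abs, abs_pow, gram]
    ring
  have hb : b ≠ 0 := h.ne_zero 1
  have hne : ‖b‖ ^ 2 • a - ⟪a, b⟫ • b ≠ 0 := fun h' => by
    have := (LinearIndependent.pair_iff.1 h (‖b‖ ^ 2) (-⟪a, b⟫)
      (by rw [neg_smul, ← sub_eq_add_neg, h'])).1
    exact hb (by simpa using this)
  have : 0 < ‖b‖ ^ 2 * gram a b := hsq ▸ pow_pos (norm_pos_iff.2 hne) 2
  exact pos_of_mul_pos_right this (sq_nonneg _)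

lemma linearIndependent_sphereInvDeriv {x a b : EuclideanSpace ℝ (Fin 3)} (hx : x ≠ 0)
    (h : LinearIndependent ℝ ![a, b]) :
    LinearIndependent ℝ ![sphereInvDeriv x a, sphereInvDeriv x b] := by
  rw [LinearIndependent.pair_iff] at h ⊢
  intro s t hst
  refine h s t ?_
  have hlin : sphereInvDeriv x (s • a + t • b) = 0 := by
    rw [← hst]
    simp only [sphereInvDeriv, inner_add_right, real_inner_smul_right]
    module
  have := norm_sphereInvDeriv_sq hx (s • a + t • b)
  rw [hlin] at this
  simpa [hx] using this

lemma meanCurv_sq_mul_sqrt {f : ℝ → ℝ → EuclideanSpace ℝ (Fin 3)} {u v : ℝ}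
    (h : LinearIndependent ℝ ![pd1 f u v, pd2 f u v]) :
    meanCurv f u v ^ 2 * √(coeffE f u v * coeffG f u v - coeffF f u v ^ 2) =
      willmoreDensity (pd1 f u v) (pd2 f u v) (pd1 (pd1 f) u v) (pd1 (pd2 f) u v)
        (pd2 (pd2 f) u v) := by
  have hD := gram_pos h
  have hW : √(gram (pd1 f u v) (pd2 f u v)) ≠ 0 := (Real.sqrt_pos.2 hD).ne'
  have hW2 : gram (pd1 f u v) (pd2 f u v) = √(gram (pd1 f u v) (pd2 f u v)) ^ 2 :=
    (Real.sq_sqrt hD.le).symm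
  have hgram : coeffE f u v * coeffG f u v - coeffF f u v ^ 2 = gram (pd1 f u v) (pd2 f u v) :=
    rfl
  rw [meanCurv, hgram, willmoreDensity, curvNumerator]
  simp only [coeffE, coeffF, coeffG, coeffL, coeffM, coeffN, unitNormal,
    real_inner_smul_right, norm_cross3]
  generalize √(gram (pd1 f u v) (pd2 f u v)) = W at *
  rw [hW2]
  field_simp
  ring

section SmoothnessOfDensities

variable {X : Type*} [NormedAddCommGroup X] [NormedSpace ℝ X] {n : WithTop ℕ∞}
  {x a b : X → EuclideanSpace ℝ (Fin 3)}

lemma contDiff_gram (ha : ContDiff ℝ n a) (hb : ContDiff ℝ n b) :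
    ContDiff ℝ n fun s => gram (a s) (b s) :=
  ((ha.norm_sq ℝ).mul (hb.norm_sq ℝ)).sub ((ha.inner ℝ hb).pow 2)

lemma contDiff_logFlux (hx : ContDiff ℝ n x) (ha : ContDiff ℝ n a) (hb : ContDiff ℝ n b)
    (h0 : ∀ s, x s ≠ 0) (hab : ∀ s, 0 < gram (a s) (b s)) :
    ContDiff ℝ n fun s => logFlux (x s) (a s) (b s) :=
  (contDiff_const.mul (((hb.norm_sq ℝ).mul (hx.inner ℝ ha)).sub
    ((ha.inner ℝ hb).mul (hx.inner ℝ hb)))).div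
    ((hx.norm_sq ℝ).mul ((contDiff_gram ha hb).sqrt fun s => (hab s).ne'))
    fun s => mul_ne_zero (pow_ne_zero 2 (norm_ne_zero_iff.2 (h0 s)))
      (Real.sqrt_pos.2 (hab s)).ne'

end SmoothnessOfDensities

section ContinuityOfDensities

variable {X : Type*} [TopologicalSpace X] {x a b p q r : X → EuclideanSpace ℝ (Fin 3)}

lemma continuous_logFluxDeriv (hx : Continuous x) (ha : Continuous a) (hb : Continuous b)
    (hp : Continuous p) (hq : Continuous q) (h0 : ∀ s, x s ≠ 0)
    (hab : ∀ s, 0 < gram (a s) (b s)) :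
    Continuous fun s => logFluxDeriv (x s) (a s) (b s) (p s) (q s) := by
  have hg : Continuous fun s => √(gram (a s) (b s)) := by unfold gram; fun_prop
  have hW (s) : √(gram (a s) (b s)) ≠ 0 := (Real.sqrt_pos.2 (hab s)).ne'
  have hρ (s) : ‖x s‖ ^ 2 ≠ 0 := pow_ne_zero 2 (norm_ne_zero_iff.2 (h0 s))
  have hden (s) : (‖x s‖ ^ 2 * √(gram (a s) (b s))) ^ 2 ≠ 0 :=
    pow_ne_zero 2 (mul_ne_zero (hρ s) (hW s))
  unfold logFluxDeriv
  fun_prop (disch := assumption)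

lemma continuous_willmoreDensity (ha : Continuous a) (hb : Continuous b)
    (hp : Continuous p) (hq : Continuous q) (hr : Continuous r)
    (hab : ∀ s, 0 < gram (a s) (b s)) :
    Continuous fun s => willmoreDensity (a s) (b s) (p s) (q s) (r s) := by
  have hg : Continuous fun s => gram (a s) (b s) := by unfold gram; fun_prop
  have hn : Continuous fun s => cross3 (a s) (b s) := by
    refine (EuclideanSpace.equiv (Fin 3) ℝ).symm.continuous.comp (continuous_pi fun i => ?_)
    fin_cases i <;> simp <;> fun_prop
  have hden (s) : 4 * gram (a s) (b s) ^ 2 * √(gram (a s) (b s)) ≠ 0 :=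
    mul_ne_zero (mul_ne_zero four_ne_zero (pow_ne_zero 2 (hab s).ne'))
      (Real.sqrt_pos.2 (hab s)).ne'
  unfold willmoreDensity curvNumerator
  fun_prop (disch := exact hden)

end ContinuityOfDensities

lemma integral_integral_add {φ ψ : ℝ → ℝ → ℝ} (hφ : Continuous fun p : ℝ × ℝ => φ p.1 p.2)
    (hψ : Continuous fun p : ℝ × ℝ => ψ p.1 p.2) (a b c d : ℝ) :
    ∫ u in a..b, ∫ v in c..d, (φ u v + ψ u v) =
      (∫ u in a..b, ∫ v in c..d, φ u v) + ∫ u in a..b, ∫ v in c..d, ψ u v := by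
  have inner_integrable {χ : ℝ → ℝ → ℝ} (hχ : Continuous fun p : ℝ × ℝ => χ p.1 p.2) (u : ℝ) :
      IntervalIntegrable (χ u) volume c d :=
    (hχ.comp (Continuous.prodMk_right u)).intervalIntegrable c d
  have outer_integrable {χ : ℝ → ℝ → ℝ} (hχ : Continuous fun p : ℝ × ℝ => χ p.1 p.2) :
      IntervalIntegrable (fun u => ∫ v in c..d, χ u v) volume a b :=
    (intervalIntegral.continuous_parametric_intervalIntegral_of_continuous'
      hχ c d).intervalIntegrable a b
  rw [← intervalIntegral.integral_add (outer_integrable hφ) (outer_integrable hψ)]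
  simp only [intervalIntegral.integral_add (inner_integrable hφ _) (inner_integrable hψ _)]

lemma contDiff_sphereInv_comp {f : ℝ → ℝ → EuclideanSpace ℝ (Fin 3)} {n : WithTop ℕ∞}
    (hf : ContDiff ℝ n (fun p : ℝ × ℝ => f p.1 p.2)) (h0 : ∀ u v, f u v ≠ 0) :
    ContDiff ℝ n (fun p : ℝ × ℝ => sphereInv (f p.1 p.2)) :=
  ((hf.norm_sq ℝ).inv fun p => pow_ne_zero 2 (norm_ne_zero_iff.2 (h0 p.1 p.2))).smul hf

/-- The Willmore energy of an immersed torus in `ℝ³` is invariant under the inversion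
`x ↦ x/‖x‖²` (Blaschke, Thomsen): if `f` is a doubly `2π`-periodic smooth immersion whose
image avoids the origin, then `x ↦ f(x)/‖f(x)‖²` is again a doubly `2π`-periodic smooth
immersion, with the same Willmore energy. -/
theorem willmoreEnergy_inversion_invariant (f : ℝ → ℝ → EuclideanSpace ℝ (Fin 3))
    (hsmooth : ContDiff ℝ (⊤ : ℕ∞) (fun p : ℝ × ℝ => f p.1 p.2))
    (hper1 : ∀ u v, f (u + 2 * π) v = f u v)
    (hper2 : ∀ u v, f u (v + 2 * π) = f u v)
    (himm : ∀ u v, LinearIndependent ℝ ![pd1 f u v, pd2 f u v])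
    (h0 : ∀ u v, f u v ≠ 0) :
    ContDiff ℝ (⊤ : ℕ∞) (fun p : ℝ × ℝ => sphereInv (f p.1 p.2)) ∧
    (∀ u v, sphereInv (f (u + 2 * π) v) = sphereInv (f u v)) ∧
    (∀ u v, sphereInv (f u (v + 2 * π)) = sphereInv (f u v)) ∧
    (∀ u v, LinearIndependent ℝ
      ![pd1 (fun x y => sphereInv (f x y)) u v, pd2 (fun x y => sphereInv (f x y)) u v]) ∧
    willmoreEnergy (fun x y => sphereInv (f x y)) = willmoreEnergy f := by
  have ha := contDiff_pd1 hsmooth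
  have hb := contDiff_pd2 hsmooth
  have hp := contDiff_pd1 ha
  have hq := contDiff_pd1 hb
  have hr := contDiff_pd2 hb
  have hab (u v : ℝ) : 0 < gram (pd1 f u v) (pd2 f u v) := gram_pos (himm u v)
  have hpd1 : pd1 (fun x y => sphereInv (f x y)) =
      fun u v => sphereInvDeriv (f u v) (pd1 f u v) := by
    funext u v
    exact (hasDerivAt_sphereInv (hasDerivAt_pd1 hsmooth u v) (h0 u v)).deriv
  have hpd2 : pd2 (fun x y => sphereInv (f x y)) =
      fun u v => sphereInvDeriv (f u v) (pd2 f u v) := by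
    funext u v
    exact (hasDerivAt_sphereInv (hasDerivAt_pd2 hsmooth u v) (h0 u v)).deriv
  have himm' (u v : ℝ) : LinearIndependent ℝ
      ![pd1 (fun x y => sphereInv (f x y)) u v, pd2 (fun x y => sphereInv (f x y)) u v] := by
    rw [hpd1, hpd2]
    exact linearIndependent_sphereInvDeriv (h0 u v) (himm u v)
  refine ⟨contDiff_sphereInv_comp hsmooth h0, fun u v => by rw [hper1], fun u v => by rw [hper2],
    himm', ?_⟩
  have hdensity (u v : ℝ) :
      willmoreDensity (pd1 (fun x y => sphereInv (f x y)) u v)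
        (pd2 (fun x y => sphereInv (f x y)) u v)
        (pd1 (pd1 (fun x y => sphereInv (f x y))) u v)
        (pd1 (pd2 (fun x y => sphereInv (f x y))) u v)
        (pd2 (pd2 (fun x y => sphereInv (f x y))) u v) =
      willmoreDensity (pd1 f u v) (pd2 f u v) (pd1 (pd1 f) u v) (pd1 (pd2 f) u v)
          (pd2 (pd2 f) u v) +
        (logFluxDeriv (f u v) (pd1 f u v) (pd2 f u v) (pd1 (pd1 f) u v) (pd1 (pd2 f) u v) +
          logFluxDeriv (f u v) (pd2 f u v) (pd1 f u v) (pd2 (pd2 f) u v)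
            (pd1 (pd2 f) u v)) := by
    have h11 : pd1 (fun u v => sphereInvDeriv (f u v) (pd1 f u v)) u v = _ :=
      (hasDerivAt_sphereInvDeriv (hasDerivAt_pd1 hsmooth u v) (hasDerivAt_pd1 ha u v)
        (h0 u v)).deriv
    have h12 : pd1 (fun u v => sphereInvDeriv (f u v) (pd2 f u v)) u v = _ :=
      (hasDerivAt_sphereInvDeriv (hasDerivAt_pd1 hsmooth u v) (hasDerivAt_pd1 hb u v)
        (h0 u v)).deriv
    have h22 : pd2 (fun u v => sphereInvDeriv (f u v) (pd2 f u v)) u v = _ :=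
      (hasDerivAt_sphereInvDeriv (hasDerivAt_pd2 hsmooth u v) (hasDerivAt_pd2 hb u v)
        (h0 u v)).deriv
    rw [hpd1, hpd2, h11, h12, h22]
    exact willmoreDensity_sphereInvDeriv (h0 u v) (hab u v) _ _ _
  have hab' (u v : ℝ) : 0 < gram (pd2 f u v) (pd1 f u v) := by
    rw [gram_comm]; exact hab u v
  have hdiv := integral_divergence_eq_zero (T := 2 * π)
    (P := fun u v => logFlux (f u v) (pd1 f u v) (pd2 f u v))
    (Q := fun u v => logFlux (f u v) (pd2 f u v) (pd1 f u v))
    ((contDiff_logFlux hsmooth ha hb (fun p => h0 p.1 p.2) fun p => hab p.1 p.2).of_le (by simp))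
    ((contDiff_logFlux hsmooth hb ha (fun p => h0 p.1 p.2) fun p => hab' p.1 p.2).of_le
      (by simp))
    (fun u v => hasDerivAt_logFlux (hasDerivAt_pd1 hsmooth u v) (hasDerivAt_pd1 ha u v)
      (hasDerivAt_pd1 hb u v) (h0 u v) (hab u v))
    (fun u v => hasDerivAt_logFlux (hasDerivAt_pd2 hsmooth u v) (hasDerivAt_pd2 hb u v)
      (hasDerivAt_pd2 ha u v) (h0 u v) (hab' u v))
    (fun v => by
      have h := hper1 0 v
      have h1 := pd1_add_left hper1 0 v
      have h2 := pd2_add_left hper1 0 v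
      rw [zero_add] at h h1 h2
      rw [h, h1, h2])
    (fun u => by
      have h := hper2 u 0
      have h1 := pd1_add_right hper2 u 0
      have h2 := pd2_add_right hper2 u 0
      rw [zero_add] at h h1 h2
      rw [h, h1, h2])
  simp only [pd2_pd1_eq_pd1_pd2 hsmooth] at hdiv
  simp only [willmoreEnergy, meanCurv_sq_mul_sqrt (himm _ _), meanCurv_sq_mul_sqrt (himm' _ _),
    hdensity]
  rw [integral_integral_add, hdiv, add_zero]
  · exact continuous_willmoreDensity ha.continuous hb.continuous hp.continuous hq.continuous
      hr.continuous fun p => hab p.1 p.2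
  · exact (continuous_logFluxDeriv hsmooth.continuous ha.continuous hb.continuous hp.continuous
      hq.continuous (fun p => h0 p.1 p.2) fun p => hab p.1 p.2).add
      (continuous_logFluxDeriv hsmooth.continuous hb.continuous ha.continuous hr.continuous
        hq.continuous (fun p => h0 p.1 p.2) fun p => hab' p.1 p.2)

end
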